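/- Let G be a finite simple graph on n vertices and v a vertex of G of degree ρ ≥ 1. Then the rank (over ℚ) of the adjacency matrix of the Fowler construction satisfies rk(A(F(G,v))) ≥ rk(A(G)) + 2ρ; equivalently, η(F(G,v)) ≤ η(G). -/

import Mathlib

open Matrix

/-- Adjacency matrix of a finite simple graph over `ℚ`. -/
noncomputable def adjMat {V : Type*} [Fintype V] [DecidableEq V] (G : SimpleGraph V) :
    Matrix V V ℚ :=
  letI := Classical.decRel G.Adj
  G.adjMatrix ℚ

/-- A core graph: some kernel eigenvector of the adjacency matrix has all entries nonzero. -/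
def IsCoreGraph {V : Type*} [Fintype V] [DecidableEq V] (G : SimpleGraph V) : Prop :=
  ∃ x : V → ℚ, (adjMat G).mulVec x = 0 ∧ ∀ w, x w ≠ 0

/-- The nullity of a graph: dimension of the kernel of its adjacency matrix. -/
noncomputable def nullity {V : Type*} [Fintype V] [DecidableEq V] (G : SimpleGraph V) : ℕ :=
  Module.finrank ℚ (LinearMap.ker (adjMat G).mulVecLin)

/-- A nut graph: a core graph of nullity one. -/
def IsNutGraph {V : Type*} [Fintype V] [DecidableEq V] (G : SimpleGraph V) : Prop :=
  IsCoreGraph G ∧ nullity G = 1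

/-- A graph is `ρ`-regular if every vertex has degree `ρ`. -/
def IsRegularGraph {V : Type*} (G : SimpleGraph V) (ρ : ℕ) : Prop :=
  ∀ w, Nat.card (G.neighborSet w) = ρ

/-- The Fowler construction `F(G,v)`. -/
def Fowler {V : Type*} (G : SimpleGraph V) (v : V) :
    SimpleGraph (V ⊕ (↥(G.neighborSet v) ⊕ ↥(G.neighborSet v))) :=
  SimpleGraph.fromRel (fun a b =>
    match a, b with
    | Sum.inl w₁, Sum.inl w₂ => G.Adj w₁ w₂ ∧ w₁ ≠ v ∧ w₂ ≠ v
    | Sum.inl w, Sum.inr (Sum.inl u) => w = (u : V)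
    | Sum.inl w, Sum.inr (Sum.inr _) => w = v
    | Sum.inr (Sum.inl u), Sum.inr (Sum.inr u') => (u : V) ≠ (u' : V)
    | _, _ => False)


theorem adjMat_mulVec_apply {V : Type*} [Fintype V] [DecidableEq V] (G : SimpleGraph V)
    [DecidableRel G.Adj] (x : V → ℚ) (a : V) :
    (adjMat G *ᵥ x) a = ∑ b, if G.Adj a b then x b else 0 := by
  simp only [adjMat, mulVec, dotProduct, SimpleGraph.adjMatrix_apply, ite_mul, one_mul, zero_mul]

theorem rank_adjMat_add_nullity {V : Type*} [Fintype V] [DecidableEq V] (G : SimpleGraph V) :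
    (adjMat G).rank + nullity G = Fintype.card V := by
  simpa [Matrix.rank, nullity] using LinearMap.finrank_range_add_finrank_ker (adjMat G).mulVecLin

namespace Fowler

section Adjacency

variable {V : Type*} (G : SimpleGraph V) (v : V)

theorem adj_inl_inl (a b : V) :
    (Fowler G v).Adj (Sum.inl a) (Sum.inl b) ↔ G.Adj a b ∧ a ≠ v ∧ b ≠ v := by
  simp only [Fowler, SimpleGraph.fromRel_adj, ne_eq, Sum.inl.injEq, G.adj_comm b a]
  have := fun h : G.Adj a b => h.ne
  tauto

theorem adj_inl_p (a : V) (u : G.neighborSet v) :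
    (Fowler G v).Adj (Sum.inl a) (Sum.inr (Sum.inl u)) ↔ a = u := by
  simp [Fowler]

theorem adj_inl_q (a : V) (u : G.neighborSet v) :
    (Fowler G v).Adj (Sum.inl a) (Sum.inr (Sum.inr u)) ↔ a = v := by
  simp [Fowler]

theorem adj_p_p (u w : G.neighborSet v) :
    ¬ (Fowler G v).Adj (Sum.inr (Sum.inl u)) (Sum.inr (Sum.inl w)) := by
  simp [Fowler]

theorem adj_p_q (u w : G.neighborSet v) :
    (Fowler G v).Adj (Sum.inr (Sum.inl u)) (Sum.inr (Sum.inr w)) ↔ u ≠ w := by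
  simp [Fowler, Subtype.ext_iff]

theorem adj_q_q (u w : G.neighborSet v) :
    ¬ (Fowler G v).Adj (Sum.inr (Sum.inr u)) (Sum.inr (Sum.inr w)) := by
  simp [Fowler]

end Adjacency

variable {V : Type*} [Fintype V] [DecidableEq V] (G : SimpleGraph V) [DecidableRel G.Adj] (v : V)

/-- The linear map restricting a vector on `F(G,v)` to `V`, with the entry at `v` replaced by
`x v + ∑ i, x pᵢ`, the common value of the `x pᵢ` when `x` is a kernel vector. -/
def contract : (V ⊕ (↥(G.neighborSet v) ⊕ ↥(G.neighborSet v)) → ℚ) →ₗ[ℚ] (V → ℚ) where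
  toFun x w := x (Sum.inl w) + if w = v then ∑ u, x (Sum.inr (Sum.inl u)) else 0
  map_add' x y := by
    ext w
    by_cases h : w = v <;> simp [h, Finset.sum_add_distrib]
    ring
  map_smul' c x := by
    ext w
    by_cases h : w = v <;> simp [h, Finset.mul_sum, mul_add]

variable {G v} {x : V ⊕ (↥(G.neighborSet v) ⊕ ↥(G.neighborSet v)) → ℚ}

theorem contract_apply_self :
    contract G v x v = x (Sum.inl v) + ∑ u, x (Sum.inr (Sum.inl u)) := by
  simp [contract]

theorem contract_apply_of_ne {w : V} (h : w ≠ v) : contract G v x w = x (Sum.inl w) := by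
  simp [contract, h]

theorem sum_q_eq_zero (hx : adjMat (Fowler G v) *ᵥ x = 0) :
    ∑ u, x (Sum.inr (Sum.inr u)) = 0 := by
  classical
  have h := congrFun hx (Sum.inl v)
  rw [adjMat_mulVec_apply] at h
  have hne : ∀ u : G.neighborSet v, v ≠ u := fun u => G.ne_of_adj u.2
  simpa [adj_inl_inl, adj_inl_p, adj_inl_q, hne] using h

theorem apply_q_eq (hx : adjMat (Fowler G v) *ᵥ x = 0) (u : G.neighborSet v) :
    x (Sum.inr (Sum.inr u)) = x (Sum.inl (u : V)) := by
  classical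
  have h := congrFun hx (Sum.inr (Sum.inl u))
  rw [adjMat_mulVec_apply] at h
  have hq := sum_q_eq_zero hx
  have he : (Finset.univ.filter fun w => ¬ u = w) = Finset.univ.erase u := by
    ext w; simp [eq_comm]
  simp only [Fintype.sum_sum_type, SimpleGraph.adj_comm _ (Sum.inr (Sum.inl u)) (Sum.inl _),
    adj_inl_p, adj_p_p, adj_p_q, ne_eq] at h
  rw [← Finset.sum_filter _ (fun w => x (Sum.inr (Sum.inr w))), he] at h
  simp at h
  linarith

theorem apply_p_eq (hx : adjMat (Fowler G v) *ᵥ x = 0) (u : G.neighborSet v) :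
    x (Sum.inr (Sum.inl u)) = contract G v x v := by
  classical
  have h := congrFun hx (Sum.inr (Sum.inr u))
  rw [adjMat_mulVec_apply] at h
  rw [contract_apply_self]
  have he : (Finset.univ.filter fun w => ¬ w = u) = Finset.univ.erase u := by
    ext w; simp
  simp only [Fintype.sum_sum_type, SimpleGraph.adj_comm _ (Sum.inr (Sum.inr u)) (Sum.inl _),
    SimpleGraph.adj_comm _ (Sum.inr (Sum.inr u)) (Sum.inr (Sum.inl _)),
    adj_inl_q, adj_q_q, adj_p_q, ne_eq] at h
  rw [← Finset.sum_filter _ (fun w => x (Sum.inr (Sum.inl w))), he] at h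
  simp at h
  linarith

theorem adjMat_mulVec_contract (hx : adjMat (Fowler G v) *ᵥ x = 0) :
    adjMat G *ᵥ contract G v x = 0 := by
  classical
  ext a
  rw [adjMat_mulVec_apply, Pi.zero_apply]
  by_cases ha : a = v
  · subst ha
    refine Eq.trans ?_ (sum_q_eq_zero hx)
    simp_rw [apply_q_eq hx]
    rw [← Finset.sum_filter, Finset.sum_subtype (p := (· ∈ G.neighborSet a)) _ (by simp)]
    exact Finset.sum_congr rfl fun u _ => contract_apply_of_ne (G.ne_of_adj u.2).symm
  · have h := congrFun hx (Sum.inl a)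
    rw [adjMat_mulVec_apply, Fintype.sum_sum_type, Fintype.sum_sum_type] at h
    simp only [adj_inl_inl, adj_inl_p, adj_inl_q, ha, if_false, Finset.sum_const_zero,
      apply_p_eq hx, Pi.zero_apply, add_zero] at h
    have hp : (∑ u : G.neighborSet v, if a = u then contract G v x v else 0) =
        if G.Adj a v then contract G v x v else 0 := by
      by_cases hav : G.Adj a v
      · rw [Finset.sum_eq_single ⟨a, hav.symm⟩] <;> simp +contextual [hav, Subtype.ext_iff, eq_comm]
      · rw [if_neg hav]
        exact Finset.sum_eq_zero fun u _ => if_neg fun hu => hav (by rw [hu]; exact G.adj_symm u.2)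
    rw [hp, ← Finset.add_sum_erase _ _ (Finset.mem_univ v)] at h
    refine Eq.trans ?_ h
    rw [← Finset.add_sum_erase _ _ (Finset.mem_univ v), add_comm]
    simp only [ne_eq, not_true, and_false, if_false, zero_add, add_left_inj]
    refine Finset.sum_congr rfl fun w hw => ?_
    have hw := Finset.ne_of_mem_erase hw
    simp [ha, hw, contract_apply_of_ne hw]

theorem eq_zero_of_contract_eq_zero (hx : adjMat (Fowler G v) *ᵥ x = 0)
    (h : contract G v x = 0) : x = 0 := by
  have hp : ∀ u, x (Sum.inr (Sum.inl u)) = 0 := fun u => by rw [apply_p_eq hx, h, Pi.zero_apply]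
  have hV : ∀ w, x (Sum.inl w) = 0 := fun w => by
    have hw := congrFun h w
    simpa [contract, hp] using hw
  ext (w | u | u)
  · exact hV w
  · exact hp u
  · rw [apply_q_eq hx, hV, Pi.zero_apply]

variable (G v)

theorem nullity_le : nullity (Fowler G v) ≤ nullity G := by
  let f : LinearMap.ker (adjMat (Fowler G v)).mulVecLin →ₗ[ℚ] LinearMap.ker (adjMat G).mulVecLin :=
    (contract G v).restrict fun x hx => adjMat_mulVec_contract hx
  refine LinearMap.finrank_le_finrank_of_injective (f := f) ?_
  rw [← LinearMap.ker_eq_bot, LinearMap.ker_eq_bot']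
  exact fun x hx => Subtype.ext (eq_zero_of_contract_eq_zero x.2 (congrArg Subtype.val hx))

end Fowler

/-- The rank of the adjacency matrix of the Fowler construction is at least
`rk(A(G)) + 2ρ`; equivalently `η(F(G,v)) ≤ η(G)`. -/
theorem fowler_rank_ge {V : Type*} [Fintype V] [DecidableEq V]
    (G : SimpleGraph V) [DecidableRel G.Adj] (v : V) (rho : ℕ) (hrho : 1 ≤ rho)
    (hdeg : Nat.card (G.neighborSet v) = rho) :
    (adjMat G).rank + 2 * rho ≤ (adjMat (Fowler G v)).rank ∧
      nullity (Fowler G v) ≤ nullity G := by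
  have hle := Fowler.nullity_le G v
  have hG := rank_adjMat_add_nullity G
  have hF := rank_adjMat_add_nullity (Fowler G v)
  rw [Fintype.card_sum, Fintype.card_sum, ← Nat.card_eq_fintype_card (α := G.neighborSet v),
    hdeg] at hF
  exact ⟨by omega, hle⟩
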